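/- Let N ≥ 3, let p, q > 0 with pq > 1, let a, b > −2, and assume the quadruple (p,q,a,b) is subcritical. Then the Hénon–Lane–Emden system (HLE) admits no positive solution (u,v) for which there exist constants C > 0 and R₀ > 0 such that u(x) ≤ C |x|^{−α̃} and v(x) ≤ C |x|^{−β̃} for all x with |x| ≥ R₀. -/

import Mathlib

open MeasureTheory Metric Set

noncomputable section

/-- Euclidean space `ℝ^N`. -/
abbrev Euc (N : ℕ) := EuclideanSpace ℝ (Fin N)

/-- The Laplacian of a function `f : ℝ^N → ℝ`, as the sum of the pure second
partial derivatives. -/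
def lap {N : ℕ} (f : Euc N → ℝ) (x : Euc N) : ℝ :=
  ∑ i : Fin N, iteratedFDeriv ℝ 2 f x ![EuclideanSpace.single i 1, EuclideanSpace.single i 1]

/-- `(u, v)` is a solution of the Hénon–Lane–Emden system
`-Δu = |x|^a |v|^{p-1} v`, `-Δv = |x|^b |u|^{q-1} u` on `ℝ^N \ {0}`:
`u, v` are `C²` on `ℝ^N \ {0}`, continuous on `ℝ^N`, and satisfy the equations pointwise. -/
def IsHLESol {N : ℕ} (p q a b : ℝ) (u v : Euc N → ℝ) : Prop :=
  ContDiffOn ℝ 2 u {x : Euc N | x ≠ 0} ∧ ContDiffOn ℝ 2 v {x : Euc N | x ≠ 0} ∧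
  Continuous u ∧ Continuous v ∧
  (∀ x : Euc N, x ≠ 0 → -lap u x = ‖x‖ ^ a * (|v x| ^ (p - 1) * v x)) ∧
  (∀ x : Euc N, x ≠ 0 → -lap v x = ‖x‖ ^ b * (|u x| ^ (q - 1) * u x))

/-- Stability of a (positive) solution of the Hénon–Lane–Emden system on an open set `Ω`:
there exist positive `C²` functions `ξ, ζ` on `Ω` with
`-Δξ ≥ p |x|^a v^{p-1} ζ` and `-Δζ ≥ q |x|^b u^{q-1} ξ` on `Ω`. -/
def HLEStableOn {N : ℕ} (p q a b : ℝ) (u v : Euc N → ℝ) (Ω : Set (Euc N)) : Prop :=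
  ∃ ξ ζ : Euc N → ℝ, ContDiffOn ℝ 2 ξ Ω ∧ ContDiffOn ℝ 2 ζ Ω ∧
    (∀ x ∈ Ω, 0 < ξ x) ∧ (∀ x ∈ Ω, 0 < ζ x) ∧
    (∀ x ∈ Ω, p * ‖x‖ ^ a * v x ^ (p - 1) * ζ x ≤ -lap ξ x) ∧
    (∀ x ∈ Ω, q * ‖x‖ ^ b * u x ^ (q - 1) * ξ x ≤ -lap ζ x)

/-- Stability outside a compact set `K`: stability on every open set whose closure is
compact and contained in `ℝ^N \ K`. -/
def HLEStableOutside {N : ℕ} (p q a b : ℝ) (u v : Euc N → ℝ) (K : Set (Euc N)) : Prop :=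
  IsCompact K ∧
    ∀ Ω : Set (Euc N), IsOpen Ω → IsCompact (closure Ω) → closure Ω ⊆ Kᶜ →
      HLEStableOn p q a b u v Ω

/-- `(u, v)` solves the Lane–Emden system `-Δu = |v|^{p-1} v`, `-Δv = |u|^{q-1} u` on `ℝ^N`. -/
def IsLESol {N : ℕ} (p q : ℝ) (u v : Euc N → ℝ) : Prop :=
  (∀ x : Euc N, -lap u x = |v x| ^ (p - 1) * v x) ∧
  (∀ x : Euc N, -lap v x = |u x| ^ (q - 1) * u x)

/-- Stability of a (positive) solution of the Lane–Emden system on an open set `Ω`. -/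
def LEStableOn {N : ℕ} (p q : ℝ) (u v : Euc N → ℝ) (Ω : Set (Euc N)) : Prop :=
  ∃ ξ ζ : Euc N → ℝ, ContDiffOn ℝ 2 ξ Ω ∧ ContDiffOn ℝ 2 ζ Ω ∧
    (∀ x ∈ Ω, 0 < ξ x) ∧ (∀ x ∈ Ω, 0 < ζ x) ∧
    (∀ x ∈ Ω, p * v x ^ (p - 1) * ζ x ≤ -lap ξ x) ∧
    (∀ x ∈ Ω, q * u x ^ (q - 1) * ξ x ≤ -lap ζ x)

/-- A function on `ℝ^N` is polynomially bounded. -/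
def PolyBounded {N : ℕ} (w : Euc N → ℝ) : Prop :=
  ∃ K L R : ℝ, 0 < K ∧ 0 < L ∧ ∀ x : Euc N, R ≤ ‖x‖ → |w x| ≤ K * ‖x‖ ^ L

/-- The polynomial `G` from Theorem 1.4 (iii). -/
def Gpoly (p q x : ℝ) : ℝ :=
  x ^ 4 - (4 * p * q * (q + 1) / (p + 1)) * x ^ 2 +
    (2 * p * q * (q + 1) * (p + q + 2) / (p + 1) ^ 2) * x -
    p * q * (q + 1) ^ 2 / (p + 1) ^ 2

/-- The `j`-th standard unit vector of `ℝ^N`. -/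
abbrev stdVec {N : ℕ} (j : Fin N) : Euc N := EuclideanSpace.single j 1

/-- The pointwise scalar product of the gradients of `f` and `g`. -/
def gradDot {N : ℕ} (f g : Euc N → ℝ) (x : Euc N) : ℝ :=
  ∑ i : Fin N, fderiv ℝ f x (stdVec i) * fderiv ℝ g x (stdVec i)

lemma sum_apply_stdVec {N : ℕ} (L : Euc N →L[ℝ] ℝ) (x : Euc N) :
    ∑ j, L (stdVec j) * x j = L x := by
  have hx : x = ∑ j, x j • stdVec j := by
    ext i
    simp [Finset.sum_apply, Pi.single_apply]
  conv_rhs => rw [hx]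
  simp [map_sum, mul_comm]

lemma sum_coord_sq {N : ℕ} (x : Euc N) : ∑ j, x j * x j = ‖x‖ ^ 2 := by
  rw [EuclideanSpace.real_norm_sq_eq]
  simp [sq]

lemma gradDot_self_nonneg {N : ℕ} (f : Euc N → ℝ) (x : Euc N) : 0 ≤ gradDot f f x :=
  Finset.sum_nonneg fun _ _ => mul_self_nonneg _

lemma abs_gradDot_le {N : ℕ} (f g : Euc N → ℝ) (x : Euc N) :
    |gradDot f g x| ≤ √(gradDot f f x) * √(gradDot g g x) := by
  rw [← Real.sqrt_mul (gradDot_self_nonneg f x)]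
  apply Real.abs_le_sqrt
  simpa only [gradDot, sq] using Finset.sum_mul_sq_le_sq_mul_sq Finset.univ
    (fun i => fderiv ℝ f x (stdVec i)) (fun i => fderiv ℝ g x (stdVec i))

lemma abs_fderiv_self_le {N : ℕ} (f : Euc N → ℝ) (x : Euc N) :
    |fderiv ℝ f x x| ≤ √(gradDot f f x) * ‖x‖ := by
  rw [← Real.sqrt_sq (norm_nonneg x), ← Real.sqrt_mul (gradDot_self_nonneg f x)]
  apply Real.abs_le_sqrt
  rw [← sum_apply_stdVec (fderiv ℝ f x) x, ← sum_coord_sq]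
  simpa only [gradDot, sq] using Finset.sum_mul_sq_le_sq_mul_sq Finset.univ
    (fun i => fderiv ℝ f x (stdVec i)) (fun i => x i)

lemma lap_eq_sum {N : ℕ} (f : Euc N → ℝ) (x : Euc N) :
    lap f x = ∑ i, fderiv ℝ (fderiv ℝ f) x (stdVec i) (stdVec i) := by
  simp [lap, iteratedFDeriv_two_apply]

/-- `φ` vanishes outside of a compact annulus centred at the origin. -/
def VanishesOffAnnulus {N : ℕ} (φ : Euc N → ℝ) : Prop :=
  ∃ r₁ r₂ : ℝ, 0 < r₁ ∧ ∀ x, φ x ≠ 0 → r₁ ≤ ‖x‖ ∧ ‖x‖ ≤ r₂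

namespace VanishesOffAnnulus

variable {N : ℕ} {φ : Euc N → ℝ}

lemma mul_right (h : VanishesOffAnnulus φ) (F : Euc N → ℝ) :
    VanishesOffAnnulus fun x => φ x * F x := by
  obtain ⟨r₁, r₂, h0, h⟩ := h
  exact ⟨r₁, r₂, h0, fun x hx => h x (left_ne_zero_of_mul hx)⟩

lemma eventuallyEq_zero (h : VanishesOffAnnulus φ) : φ =ᶠ[nhds 0] fun _ => 0 := by
  obtain ⟨r₁, r₂, h0, h⟩ := h
  filter_upwards [Metric.ball_mem_nhds (0 : Euc N) h0] with x hx
  by_contra hne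
  have := (h x hne).1
  rw [mem_ball_zero_iff] at hx
  linarith

lemma hasCompactSupport (h : VanishesOffAnnulus φ) : HasCompactSupport φ := by
  obtain ⟨r₁, r₂, h0, h⟩ := h
  refine HasCompactSupport.intro (isCompact_closedBall (0 : Euc N) r₂) fun x hx => ?_
  by_contra hne
  exact hx (by simpa using (h x hne).2)

lemma continuous_mul (h : VanishesOffAnnulus φ) (hφ : Continuous φ) {F : Euc N → ℝ}
    (hF : ∀ x, x ≠ 0 → ContinuousAt F x) : Continuous fun x => φ x * F x := by
  rw [continuous_iff_continuousAt]
  intro x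
  by_cases hx : x = 0
  · subst hx
    exact continuousAt_const.congr (h.mul_right F).eventuallyEq_zero.symm
  · exact hφ.continuousAt.mul (hF x hx)

lemma integrable_mul (h : VanishesOffAnnulus φ) (hφ : Continuous φ) {F : Euc N → ℝ}
    (hF : ∀ x, x ≠ 0 → ContinuousAt F x) : Integrable fun x => φ x * F x :=
  (h.continuous_mul hφ hF).integrable_of_hasCompactSupport (h.mul_right F).hasCompactSupport

lemma contDiff_mul (h : VanishesOffAnnulus φ) (hφ : ContDiff ℝ 1 φ) {F : Euc N → ℝ}
    (hF : ∀ x, x ≠ 0 → ContDiffAt ℝ 1 F x) : ContDiff ℝ 1 fun x => φ x * F x := by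
  rw [contDiff_iff_contDiffAt]
  intro x
  by_cases hx : x = 0
  · subst hx
    exact contDiffAt_const.congr_of_eventuallyEq (h.mul_right F).eventuallyEq_zero
  · exact hφ.contDiffAt.mul (hF x hx)

lemma fderiv_apply (h : VanishesOffAnnulus φ) (w : Euc N) :
    VanishesOffAnnulus fun x => fderiv ℝ φ x w := by
  obtain ⟨r₁, r₂, h0, h⟩ := h
  refine ⟨r₁, r₂, h0, fun x hx => ?_⟩
  have hsub : tsupport φ ⊆ {x | r₁ ≤ ‖x‖ ∧ ‖x‖ ≤ r₂} :=
    closure_minimal (fun y hy => h y hy)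
      ((isClosed_le continuous_const continuous_norm).inter
        (isClosed_le continuous_norm continuous_const))
  refine hsub (support_fderiv_subset ℝ (f := φ) ?_)
  intro h0
  exact hx (by simp [h0])

end VanishesOffAnnulus

lemma integral_fderiv_apply_eq_zero {N : ℕ} {f : Euc N → ℝ} (hf : ContDiff ℝ 1 f)
    (hs : HasCompactSupport f) (w : Euc N) : ∫ x, fderiv ℝ f x w = 0 := by
  have hi : Integrable fun x => fderiv ℝ f x w :=
    ((hf.continuous_fderiv one_ne_zero).clm_apply continuous_const).integrable_of_hasCompactSupport
      (hs.fderiv_apply (𝕜 := ℝ) w)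
  have := integral_mul_fderiv_eq_neg_fderiv_mul_of_integrable (μ := (volume : Measure (Euc N)))
    (f := fun _ => (1 : ℝ)) (g := f) (v := w) (by simp) (by simpa using hi)
    (by simpa using hf.continuous.integrable_of_hasCompactSupport hs)
    (by fun_prop) (fun x _ => hf.differentiable one_ne_zero x)
  simpa using this

/-- Divergence theorem against a cutoff supported away from the origin. -/
lemma integral_mul_div {N : ℕ} {φ : Euc N → ℝ} (h : VanishesOffAnnulus φ)
    (hφ : ContDiff ℝ 1 φ) {F : Fin N → Euc N → ℝ}
    (hF : ∀ j x, x ≠ 0 → ContDiffAt ℝ 1 (F j) x) :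
    ∫ x, φ x * ∑ j, fderiv ℝ (F j) x (stdVec j) =
      -∫ x, ∑ j, fderiv ℝ φ x (stdVec j) * F j x := by
  have hdφ : ∀ w, Continuous fun x => fderiv ℝ φ x w := fun w =>
    (hφ.continuous_fderiv one_ne_zero).clm_apply continuous_const
  have hi1 : ∀ j, Integrable fun x => φ x * fderiv ℝ (F j) x (stdVec j) := fun j =>
    h.integrable_mul hφ.continuous fun x hx =>
      ((hF j x hx).continuousAt_fderiv one_ne_zero).clm_apply continuousAt_const
  have hi2 : ∀ j, Integrable fun x => fderiv ℝ φ x (stdVec j) * F j x := fun j =>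
    (h.fderiv_apply _).integrable_mul (hdφ _) fun x hx => (hF j x hx).continuousAt
  have key : ∀ j, ∫ x, φ x * fderiv ℝ (F j) x (stdVec j) =
      -∫ x, fderiv ℝ φ x (stdVec j) * F j x := by
    intro j
    have h0 := integral_fderiv_apply_eq_zero (h.contDiff_mul hφ (hF j))
      (h.mul_right _).hasCompactSupport (stdVec j)
    have heq : ∀ x, fderiv ℝ (fun x => φ x * F j x) x (stdVec j) =
        φ x * fderiv ℝ (F j) x (stdVec j) + fderiv ℝ φ x (stdVec j) * F j x := by
      intro x
      by_cases hx : x = 0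
      · subst hx
        rw [(h.mul_right (F j)).eventuallyEq_zero.fderiv_eq, h.eventuallyEq_zero.fderiv_eq,
          h.eventuallyEq_zero.eq_of_nhds]
        simp
      · rw [fderiv_fun_mul (hφ.differentiable one_ne_zero x)
          ((hF j x hx).differentiableAt one_ne_zero)]
        simp [mul_comm]
    simp_rw [heq] at h0
    rw [integral_add (hi1 j) (hi2 j)] at h0
    linarith
  simp_rw [Finset.mul_sum]
  rw [integral_finsetSum _ fun j _ => hi1 j, integral_finsetSum _ fun j _ => hi2 j,
    ← Finset.sum_neg_distrib]
  exact Finset.sum_congr rfl fun j _ => key j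

lemma hasFDerivAt_radial {N : ℕ} {k : ℝ → ℝ} (hk : Differentiable ℝ k) (r : ℝ) (x : Euc N) :
    HasFDerivAt (fun y : Euc N => k (‖y‖ ^ 2 / r ^ 2))
      (deriv k (‖x‖ ^ 2 / r ^ 2) • ((r ^ 2)⁻¹ • (2 • innerSL ℝ x))) x := by
  have h1 : HasFDerivAt (fun y : Euc N => ‖y‖ ^ 2 / r ^ 2) ((r ^ 2)⁻¹ • (2 • innerSL ℝ x)) x := by
    have := (hasStrictFDerivAt_norm_sq x).hasFDerivAt.mul_const ((r ^ 2)⁻¹)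
    simpa only [div_eq_mul_inv] using this
  exact (hk _).hasDerivAt.comp_hasFDerivAt x h1

lemma sum_fderiv_radial_mul {N : ℕ} {k : ℝ → ℝ} (hk : Differentiable ℝ k) (r : ℝ) (x : Euc N)
    (F : Fin N → ℝ) :
    ∑ j, fderiv ℝ (fun y : Euc N => k (‖y‖ ^ 2 / r ^ 2)) x (stdVec j) * F j =
      deriv k (‖x‖ ^ 2 / r ^ 2) * (2 / r ^ 2) * ∑ j, F j * x j := by
  rw [(hasFDerivAt_radial hk r x).fderiv, Finset.mul_sum]
  refine Finset.sum_congr rfl fun j _ => ?_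
  simp [EuclideanSpace.inner_single_right]
  ring

lemma contDiff_radial {N : ℕ} {k : ℝ → ℝ} {n : WithTop ℕ∞} (hk : ContDiff ℝ n k) (r : ℝ) :
    ContDiff ℝ n fun y : Euc N => k (‖y‖ ^ 2 / r ^ 2) :=
  hk.comp ((contDiff_norm_sq ℝ).div_const _)

lemma annulus_of_sq_div {s r : ℝ} (hs : 0 ≤ s) (hr : 0 < r)
    (h : 1 / 4 ≤ s ^ 2 / r ^ 2 ∧ s ^ 2 / r ^ 2 ≤ 16) : r / 2 ≤ s ∧ s ≤ 4 * r := by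
  have hr2 : 0 < r ^ 2 := by positivity
  rw [le_div_iff₀ hr2, div_le_iff₀ hr2] at h
  constructor <;> nlinarith

lemma vanishesOffAnnulus_radial {N : ℕ} {k : ℝ → ℝ}
    (hk : ∀ t, k t ≠ 0 → 1 / 4 ≤ t ∧ t ≤ 16) {r : ℝ} (hr : 0 < r) :
    VanishesOffAnnulus fun y : Euc N => k (‖y‖ ^ 2 / r ^ 2) :=
  ⟨r / 2, 4 * r, by positivity, fun x hx => annulus_of_sq_div (norm_nonneg x) hr (hk _ hx)⟩

lemma contDiffAt_gradDot {N : ℕ} {f g : Euc N → ℝ} {x : Euc N}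
    (hf : ContDiffAt ℝ 2 f x) (hg : ContDiffAt ℝ 2 g x) : ContDiffAt ℝ 1 (gradDot f g) x := by
  have hf' : ContDiffAt ℝ 1 (fderiv ℝ f) x := hf.fderiv_right (by norm_num)
  have hg' : ContDiffAt ℝ 1 (fderiv ℝ g) x := hg.fderiv_right (by norm_num)
  exact ContDiffAt.sum fun i _ =>
    (hf'.clm_apply contDiffAt_const).mul (hg'.clm_apply contDiffAt_const)

lemma div_mul_gradient {N : ℕ} {f g : Euc N → ℝ} {x : Euc N}
    (hf : ContDiffAt ℝ 1 f x) (hg : ContDiffAt ℝ 2 g x) :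
    ∑ j, fderiv ℝ (fun y => f y * fderiv ℝ g y (stdVec j)) x (stdVec j) =
      gradDot f g x + f x * lap g x := by
  have hg' : DifferentiableAt ℝ (fderiv ℝ g) x :=
    (hg.fderiv_right (m := 1) (by norm_num)).differentiableAt one_ne_zero
  rw [lap_eq_sum, gradDot, Finset.mul_sum, ← Finset.sum_add_distrib]
  refine Finset.sum_congr rfl fun j _ => ?_
  have h := (hf.differentiableAt one_ne_zero).hasFDerivAt.fun_mul
    (hg'.hasFDerivAt.clm_apply (hasFDerivAt_const (stdVec j) x))
  rw [HasFDerivAt.fderiv h]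
  simp
  ring

/-- Caccioppoli's inequality on a dyadic annulus. -/
lemma integral_gradDot_self_le {N : ℕ} {g : ℝ → ℝ} (hg : ContDiff ℝ 1 g)
    (hgs : ∀ t, g t ≠ 0 → 1 / 4 ≤ t ∧ t ≤ 16) (hg1 : ∀ t, |g t| ≤ 1) {M : ℝ}
    (hM : ∀ t, |deriv g t| ≤ M) {w : Euc N → ℝ} (hw : ∀ x, x ≠ 0 → ContDiffAt ℝ 2 w x)
    {r A : ℝ} (hr : 0 < r) (hA : 0 < A)
    (hb : ∀ x : Euc N, r / 2 ≤ ‖x‖ → ‖x‖ ≤ 4 * r →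
      0 ≤ w x ∧ w x ≤ A ∧ 0 ≤ -lap w x ∧ ‖x‖ ^ 2 * -lap w x ≤ A) :
    ∫ x, g (‖x‖ ^ 2 / r ^ 2) ^ 2 * gradDot w w x ≤
      2 * ((4 + 128 * M ^ 2) * A ^ 2 / r ^ 2 *
        volume.real (closedBall (0 : Euc N) (4 * r))) := by
  have hM0 : 0 ≤ M := (abs_nonneg _).trans (hM 0)
  set K := (4 + 128 * M ^ 2) * A ^ 2 / r ^ 2 with hK
  have hg2 : ContDiff ℝ 1 fun t => g t ^ 2 := hg.pow 2
  have hg2s : ∀ t, (fun t => g t ^ 2) t ≠ 0 → 1 / 4 ≤ t ∧ t ≤ 16 := fun t ht =>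
    hgs t fun h => ht (by simp [h])
  have hφ := vanishesOffAnnulus_radial (N := N) hg2s hr
  have hφc := contDiff_radial (N := N) hg2 r
  have hw1 : ∀ x, x ≠ 0 → ContDiffAt ℝ 1 w x := fun x hx => (hw x hx).of_le (by norm_num)
  have hF : ∀ (j : Fin N) x, x ≠ 0 →
      ContDiffAt ℝ 1 (fun y => w y * fderiv ℝ w y (stdVec j)) x := fun j x hx =>
    (hw1 x hx).mul (((hw x hx).fderiv_right (m := 1) (by norm_num)).clm_apply contDiffAt_const)
  have hdiv := integral_mul_div hφ hφc hF
  have hgcont := fun x hx => (contDiffAt_gradDot (hw x hx) (hw x hx)).continuousAt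
  have hsum : ∀ x, x ≠ 0 → ContinuousAt (fun x =>
      ∑ j, fderiv ℝ (fun y => w y * fderiv ℝ w y (stdVec j)) x (stdVec j)) x := fun x hx =>
    tendsto_finsetSum _ fun j _ =>
      ((hF j x hx).continuousAt_fderiv one_ne_zero).clm_apply continuousAt_const
  have hi1 := hφ.integrable_mul hφc.continuous hsum
  have hi2 : Integrable fun x => ∑ j, fderiv ℝ (fun y : Euc N => g (‖y‖ ^ 2 / r ^ 2) ^ 2) x
      (stdVec j) * (w x * fderiv ℝ w x (stdVec j)) :=
    integrable_finsetSum _ fun j _ => (hφ.fderiv_apply _).integrable_mul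
      ((hφc.continuous_fderiv one_ne_zero).clm_apply continuous_const)
      fun x hx => (hF j x hx).continuousAt
  have hi3 := hφ.integrable_mul hφc.continuous hgcont
  have hi4 : Integrable ((closedBall (0 : Euc N) (4 * r)).indicator fun _ => K) :=
    (integrable_indicator_iff measurableSet_closedBall).2
      (integrableOn_const measure_closedBall_lt_top.ne)
  have hpt : ∀ x, 1 / 2 * (g (‖x‖ ^ 2 / r ^ 2) ^ 2 * gradDot w w x) ≤
      g (‖x‖ ^ 2 / r ^ 2) ^ 2 *
        ∑ j, fderiv ℝ (fun y => w y * fderiv ℝ w y (stdVec j)) x (stdVec j) +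
      ∑ j, fderiv ℝ (fun y : Euc N => g (‖y‖ ^ 2 / r ^ 2) ^ 2) x
        (stdVec j) * (w x * fderiv ℝ w x (stdVec j)) +
      (closedBall (0 : Euc N) (4 * r)).indicator (fun _ => K) x := by
    intro x
    rw [sum_fderiv_radial_mul (hg2.differentiable one_ne_zero)]
    have hd : deriv (fun t => g t ^ 2) (‖x‖ ^ 2 / r ^ 2) =
        2 * g (‖x‖ ^ 2 / r ^ 2) * deriv g (‖x‖ ^ 2 / r ^ 2) := by
      rw [deriv_fun_pow (hg.differentiable one_ne_zero _)]
      simp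
    rw [hd]
    have hK0 : 0 ≤ K := by positivity
    by_cases hgx : g (‖x‖ ^ 2 / r ^ 2) = 0
    · simp only [hgx]
      simpa using indicator_nonneg (fun _ _ => hK0) x
    obtain ⟨hx1, hx2⟩ := annulus_of_sq_div (norm_nonneg x) hr (hgs _ hgx)
    have hx0 : x ≠ 0 := by
      rintro rfl
      simp at hx1
      linarith
    obtain ⟨hw0, hwA, hl0, hlA⟩ := hb x hx1 hx2
    rw [indicator_of_mem (by simpa using hx2), div_mul_gradient (hw1 x hx0) (hw x hx0)]
    have hP : ∑ j, w x * fderiv ℝ w x (stdVec j) * x j = w x * fderiv ℝ w x x := by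
      rw [← sum_apply_stdVec (fderiv ℝ w x) x, Finset.mul_sum]
      exact Finset.sum_congr rfl fun j _ => by ring
    rw [hP]
    set γ := g (‖x‖ ^ 2 / r ^ 2)
    set δ := deriv g (‖x‖ ^ 2 / r ^ 2)
    set G := gradDot w w x with hG
    have hG0 : 0 ≤ G := gradDot_self_nonneg w x
    have hγ1 : γ ^ 2 ≤ 1 := by
      rw [← sq_abs]
      exact pow_le_one₀ (abs_nonneg _) (hg1 _)
    have hsq : √G ^ 2 = G := Real.sq_sqrt hG0
    have hcross : |2 * γ * δ * (2 / r ^ 2) * (w x * fderiv ℝ w x x)| ≤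
        16 * |γ| * √G * (M * A / r) := by
      have hP' : |fderiv ℝ w x x| ≤ √G * (4 * r) :=
        (abs_fderiv_self_le w x).trans (by gcongr)
      rw [abs_mul, abs_mul, abs_mul, abs_mul, abs_mul, abs_of_nonneg hw0,
        abs_of_nonneg (show (0 : ℝ) ≤ 2 / r ^ 2 by positivity), abs_two]
      calc 2 * |γ| * |δ| * (2 / r ^ 2) * (w x * |fderiv ℝ w x x|)
          ≤ 2 * |γ| * M * (2 / r ^ 2) * (A * (√G * (4 * r))) := by
            gcongr
            exact hM _
        _ = 16 * |γ| * √G * (M * A / r) := by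
            field_simp
            ring
    have hyoung : 16 * |γ| * √G * (M * A / r) ≤
        1 / 2 * (γ ^ 2 * G) + 128 * M ^ 2 * A ^ 2 / r ^ 2 := by
      have h1 := sq_nonneg (|γ| * √G - 16 * (M * A / r))
      have h2 : (|γ| * √G) ^ 2 = γ ^ 2 * G := by rw [mul_pow, sq_abs, hsq]
      have h3 : 128 * M ^ 2 * A ^ 2 / r ^ 2 = 128 * (M * A / r) ^ 2 := by
        rw [div_pow, mul_pow]
        ring
      rw [h3]
      nlinarith
    have hlap : γ ^ 2 * (w x * -lap w x) ≤ 4 * A ^ 2 / r ^ 2 := by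
      have h1 : -lap w x ≤ 4 * A / r ^ 2 := by
        rw [le_div_iff₀ (by positivity)]
        have : (r / 2) ^ 2 ≤ ‖x‖ ^ 2 := by gcongr
        nlinarith
      calc γ ^ 2 * (w x * -lap w x) ≤ 1 * (A * (4 * A / r ^ 2)) := by gcongr
        _ = _ := by ring
    have hKs : K = 4 * A ^ 2 / r ^ 2 + 128 * M ^ 2 * A ^ 2 / r ^ 2 := by
      rw [hK]
      ring
    have := neg_abs_le (2 * γ * δ * (2 / r ^ 2) * (w x * fderiv ℝ w x x))
    rw [hKs]
    nlinarith
  have hint := integral_mono (hi3.const_mul (1 / 2)) ((hi1.fun_add hi2).fun_add hi4) hpt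
  rw [integral_const_mul, integral_add (hi1.fun_add hi2) hi4,
    integral_add hi1 hi2, hdiv, integral_indicator measurableSet_closedBall,
    setIntegral_const, smul_eq_mul] at hint
  linarith

/-- The vector field of the Rellich–Pohozaev identity for a pair `(u, v)` with potential `H`
and weights `lam`, `mu`. -/
def pohozaevField {N : ℕ} (u v H : Euc N → ℝ) (lam mu : ℝ) (j : Fin N) (x : Euc N) : ℝ :=
  fderiv ℝ u x x * fderiv ℝ v x (stdVec j) + fderiv ℝ v x x * fderiv ℝ u x (stdVec j) -
    gradDot u v x * x j + H x * x j +
    lam * (v x * fderiv ℝ u x (stdVec j)) + mu * (u x * fderiv ℝ v x (stdVec j))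

/-- The scalar product of the Rellich–Pohozaev field with the position vector. -/
def pohozaevFlux {N : ℕ} (u v H : Euc N → ℝ) (lam mu : ℝ) (x : Euc N) : ℝ :=
  2 * (fderiv ℝ u x x * fderiv ℝ v x x) - gradDot u v x * ‖x‖ ^ 2 + H x * ‖x‖ ^ 2 +
    lam * (v x * fderiv ℝ u x x) + mu * (u x * fderiv ℝ v x x)

lemma sum_pohozaevField_mul {N : ℕ} (u v H : Euc N → ℝ) (lam mu : ℝ) (x : Euc N) :
    ∑ j, pohozaevField u v H lam mu j x * x j = pohozaevFlux u v H lam mu x := by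
  have hu := sum_apply_stdVec (fderiv ℝ u x) x
  have hv := sum_apply_stdVec (fderiv ℝ v x) x
  have hx := sum_coord_sq x
  calc ∑ j, pohozaevField u v H lam mu j x * x j
      = fderiv ℝ u x x * ∑ j, fderiv ℝ v x (stdVec j) * x j +
        fderiv ℝ v x x * ∑ j, fderiv ℝ u x (stdVec j) * x j -
        gradDot u v x * ∑ j, x j * x j + H x * ∑ j, x j * x j +
        lam * (v x * ∑ j, fderiv ℝ u x (stdVec j) * x j) +
        mu * (u x * ∑ j, fderiv ℝ v x (stdVec j) * x j) := by
        simp only [Finset.mul_sum, ← Finset.sum_add_distrib, ← Finset.sum_sub_distrib]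
        exact Finset.sum_congr rfl fun j _ => by simp only [pohozaevField]; ring
    _ = pohozaevFlux u v H lam mu x := by
        rw [hu, hv, hx, pohozaevFlux]
        ring

section

variable {N : ℕ} {u v H : Euc N → ℝ} {lam mu : ℝ}

lemma contDiffAt_pohozaevField {x : Euc N} (hu : ContDiffAt ℝ 2 u x)
    (hv : ContDiffAt ℝ 2 v x) (hH : ContDiffAt ℝ 1 H x) (j : Fin N) :
    ContDiffAt ℝ 1 (pohozaevField u v H lam mu j) x := by
  have hu' : ContDiffAt ℝ 1 (fderiv ℝ u) x := hu.fderiv_right (by norm_num)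
  have hv' : ContDiffAt ℝ 1 (fderiv ℝ v) x := hv.fderiv_right (by norm_num)
  have hu1 : ContDiffAt ℝ 1 u x := hu.of_le (by norm_num)
  have hv1 : ContDiffAt ℝ 1 v x := hv.of_le (by norm_num)
  have hc : ContDiffAt ℝ 1 (fun y : Euc N => y j) x := by fun_prop
  have hid : ContDiffAt ℝ 1 (fun y : Euc N => y) x := contDiffAt_id
  have hue := hu'.clm_apply (contDiffAt_const (c := stdVec j))
  have hve := hv'.clm_apply (contDiffAt_const (c := stdVec j))
  exact ((((((hu'.clm_apply hid).mul hve).add ((hv'.clm_apply hid).mul hue)).sub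
    ((contDiffAt_gradDot hu hv).mul hc)).add (hH.mul hc)).add
    (contDiffAt_const.mul (hv1.mul hue))).add (contDiffAt_const.mul (hu1.mul hve))

lemma continuousAt_pohozaevFlux {x : Euc N} (hu : ContDiffAt ℝ 2 u x)
    (hv : ContDiffAt ℝ 2 v x) (hH : ContDiffAt ℝ 1 H x) :
    ContinuousAt (pohozaevFlux u v H lam mu) x := by
  have h : pohozaevFlux u v H lam mu =
      fun x => ∑ j, pohozaevField u v H lam mu j x * x j :=
    funext fun x => (sum_pohozaevField_mul u v H lam mu x).symm
  rw [h]
  exact tendsto_finsetSum _ fun j _ =>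
    (contDiffAt_pohozaevField hu hv hH j).continuousAt.mul
      (show ContinuousAt (fun y : Euc N => y j) x by fun_prop)

lemma div_pohozaevField {x : Euc N} (hu : ContDiffAt ℝ 2 u x)
    (hv : ContDiffAt ℝ 2 v x) (hH : ContDiffAt ℝ 1 H x) :
    ∑ j, fderiv ℝ (pohozaevField u v H lam mu j) x (stdVec j) =
      fderiv ℝ u x x * lap v x + fderiv ℝ v x x * lap u x +
      (2 - N + lam + mu) * gradDot u v x + N * H x + fderiv ℝ H x x +
      lam * (v x * lap u x) + mu * (u x * lap v x) := by
  have hu2 := ((hu.fderiv_right (m := 1) (by norm_num)).differentiableAt one_ne_zero).hasFDerivAt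
  have hv2 := ((hv.fderiv_right (m := 1) (by norm_num)).differentiableAt one_ne_zero).hasFDerivAt
  have hu1 := (hu.differentiableAt two_ne_zero).hasFDerivAt
  have hv1 := (hv.differentiableAt two_ne_zero).hasFDerivAt
  have hH1 := (hH.differentiableAt one_ne_zero).hasFDerivAt
  have hus : IsSymmSndFDerivAt ℝ u x := hu.isSymmSndFDerivAt (by simp)
  have hvs : IsSymmSndFDerivAt ℝ v x := hv.isSymmSndFDerivAt (by simp)
  set U := fderiv ℝ (fderiv ℝ u) x
  set V := fderiv ℝ (fderiv ℝ v) x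
  have hG := ((contDiffAt_gradDot hu hv).differentiableAt one_ne_zero).hasFDerivAt
  have hGx : fderiv ℝ (gradDot u v) x x =
      ∑ i, (U x (stdVec i) * fderiv ℝ v x (stdVec i) +
        fderiv ℝ u x (stdVec i) * V x (stdVec i)) := by
    have h : HasFDerivAt (gradDot u v) _ x := HasFDerivAt.fun_sum fun i _ =>
      (hu2.clm_apply (hasFDerivAt_const (stdVec i) x)).fun_mul
        (hv2.clm_apply (hasFDerivAt_const (stdVec i) x))
    rw [h.fderiv]
    simp only [sum_apply]
    refine Finset.sum_congr rfl fun i _ => ?_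
    simp
    ring
  have hj : ∀ j, fderiv ℝ (pohozaevField u v H lam mu j) x (stdVec j) =
      U x (stdVec j) * fderiv ℝ v x (stdVec j) + fderiv ℝ u x (stdVec j) * V x (stdVec j) +
      fderiv ℝ u x x * V (stdVec j) (stdVec j) + fderiv ℝ v x x * U (stdVec j) (stdVec j) +
      2 * (fderiv ℝ u x (stdVec j) * fderiv ℝ v x (stdVec j)) -
      fderiv ℝ (gradDot u v) x (stdVec j) * x j - gradDot u v x +
      fderiv ℝ H x (stdVec j) * x j + H x +
      (lam + mu) * (fderiv ℝ u x (stdVec j) * fderiv ℝ v x (stdVec j)) +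
      lam * (v x * U (stdVec j) (stdVec j)) + mu * (u x * V (stdVec j) (stdVec j)) := by
    intro j
    have hue := hu2.clm_apply (hasFDerivAt_const (stdVec j) x)
    have hve := hv2.clm_apply (hasFDerivAt_const (stdVec j) x)
    have hux := hu2.clm_apply (hasFDerivAt_id x)
    have hvx := hv2.clm_apply (hasFDerivAt_id x)
    have hc : HasFDerivAt (fun y : Euc N => y j) (EuclideanSpace.proj j : Euc N →L[ℝ] ℝ) x :=
      (EuclideanSpace.proj j : Euc N →L[ℝ] ℝ).hasFDerivAt
    have h : HasFDerivAt (pohozaevField u v H lam mu j) _ x :=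
      ((((((hux.fun_mul hve).fun_add (hvx.fun_mul hue)).fun_sub (hG.fun_mul hc)).fun_add
        (hH1.fun_mul hc)).fun_add ((hv1.fun_mul hue).const_mul lam)).fun_add
        ((hu1.fun_mul hve).const_mul mu))
    rw [h.fderiv]
    have e1 := hus.eq (stdVec j) x
    have e2 := hvs.eq (stdVec j) x
    simp only [add_apply, sub_apply, smul_apply, smul_eq_mul,
      ContinuousLinearMap.comp_apply, ContinuousLinearMap.flip_apply, id_eq,
      zero_apply, map_zero, ContinuousLinearMap.id_apply]
    simp only [PiLp.proj_apply, PiLp.single_apply, if_true]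
    rw [show U (stdVec j) x = U x (stdVec j) from e1, show V (stdVec j) x = V x (stdVec j) from e2]
    ring
  simp only [hj, Finset.sum_add_distrib, Finset.sum_sub_distrib, ← Finset.mul_sum,
    sum_apply_stdVec]
  rw [hGx, lap_eq_sum, lap_eq_sum, gradDot, Finset.sum_add_distrib]
  simp only [Finset.sum_const, Finset.card_univ, Fintype.card_fin, nsmul_eq_mul]
  ring

/-- Scale-invariant bound for the flux of the Rellich–Pohozaev field through an annulus. -/
lemma abs_integral_flux_le {θ g : ℝ → ℝ} {M : ℝ}
    (hθs : ∀ t, deriv θ t ≠ 0 → 1 ≤ t ∧ t ≤ 4)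
    (hθM : ∀ t, |deriv θ t| ≤ M) (hg : ContDiff ℝ 1 g)
    (hgs : ∀ t, g t ≠ 0 → 1 / 4 ≤ t ∧ t ≤ 16) (hg1 : ∀ t, |g t| ≤ 1)
    (hgone : ∀ t, 1 ≤ t → t ≤ 4 → g t = 1) (hgM : ∀ t, |deriv g t| ≤ M)
    (hu : ∀ x, x ≠ 0 → ContDiffAt ℝ 2 u x) (hv : ∀ x, x ≠ 0 → ContDiffAt ℝ 2 v x)
    {r A B : ℝ} (hr : 0 < r) (hA : 0 < A) (hB : 0 < B)
    (hbu : ∀ x : Euc N, r / 2 ≤ ‖x‖ → ‖x‖ ≤ 4 * r →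
      0 ≤ u x ∧ u x ≤ A ∧ 0 ≤ -lap u x ∧ ‖x‖ ^ 2 * -lap u x ≤ A)
    (hbv : ∀ x : Euc N, r / 2 ≤ ‖x‖ → ‖x‖ ≤ 4 * r →
      0 ≤ v x ∧ v x ≤ B ∧ 0 ≤ -lap v x ∧ ‖x‖ ^ 2 * -lap v x ≤ B)
    (hbH : ∀ x : Euc N, r / 2 ≤ ‖x‖ → ‖x‖ ≤ 4 * r → |H x| * ‖x‖ ^ 2 ≤ 2 * (A * B)) :
    |∫ x, deriv θ (‖x‖ ^ 2 / r ^ 2) * ((2 / r ^ 2) * pohozaevFlux u v H lam mu x)| ≤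
      2 * M * (6 + |lam| + |mu|) * (4 * (4 + 128 * M ^ 2) + 1) *
        (A * B / r ^ 2 * volume.real (closedBall (0 : Euc N) (4 * r))) := by
  have hM0 : 0 ≤ M := (abs_nonneg _).trans (hθM 0)
  set c := 2 * M * (6 + |lam| + |mu|) with hc
  have hc0 : 0 ≤ c := by positivity
  set W := volume.real (closedBall (0 : Euc N) (4 * r))
  have hg2 : ContDiff ℝ 1 fun t => g t ^ 2 := hg.pow 2
  have hg2s : ∀ t, (fun t => g t ^ 2) t ≠ 0 → 1 / 4 ≤ t ∧ t ≤ 16 := fun t ht =>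
    hgs t fun h => ht (by simp [h])
  have hφ := vanishesOffAnnulus_radial (N := N) hg2s hr
  have hφc := contDiff_radial (N := N) hg2 r
  have hIu := hφ.integrable_mul hφc.continuous
    fun x hx => (contDiffAt_gradDot (hu x hx) (hu x hx)).continuousAt
  have hIv := hφ.integrable_mul hφc.continuous
    fun x hx => (contDiffAt_gradDot (hv x hx) (hv x hx)).continuousAt
  have hIK : Integrable ((closedBall (0 : Euc N) (4 * r)).indicator fun _ => A * B / r ^ 2) :=
    (integrable_indicator_iff measurableSet_closedBall).2
      (integrableOn_const measure_closedBall_lt_top.ne)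
  have hCu := integral_gradDot_self_le hg hgs hg1 hgM hu hr hA hbu
  have hCv := integral_gradDot_self_le hg hgs hg1 hgM hv hr hB hbv
  have hpt : ∀ x, ‖deriv θ (‖x‖ ^ 2 / r ^ 2) * ((2 / r ^ 2) * pohozaevFlux u v H lam mu x)‖ ≤
      c * (B / A * (g (‖x‖ ^ 2 / r ^ 2) ^ 2 * gradDot u u x) +
        A / B * (g (‖x‖ ^ 2 / r ^ 2) ^ 2 * gradDot v v x) +
        (closedBall (0 : Euc N) (4 * r)).indicator (fun _ => A * B / r ^ 2) x) := by
    intro x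
    have hGu : 0 ≤ gradDot u u x := gradDot_self_nonneg u x
    have hGv : 0 ≤ gradDot v v x := gradDot_self_nonneg v x
    by_cases hd : deriv θ (‖x‖ ^ 2 / r ^ 2) = 0
    · rw [hd, zero_mul, norm_zero]
      have := indicator_nonneg (s := closedBall (0 : Euc N) (4 * r))
        (f := fun _ => A * B / r ^ 2) (fun _ _ => by positivity) x
      positivity
    obtain ⟨hs1, hs4⟩ := hθs _ hd
    have hr2 : 0 < r ^ 2 := by positivity
    have hx1 : r ≤ ‖x‖ := by
      rw [le_div_iff₀ hr2] at hs1
      nlinarith [norm_nonneg x]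
    have hx2 : ‖x‖ ≤ 2 * r := by
      rw [div_le_iff₀ hr2] at hs4
      nlinarith [norm_nonneg x]
    have hxa : r / 2 ≤ ‖x‖ := by linarith
    have hxb : ‖x‖ ≤ 4 * r := by linarith
    obtain ⟨hu0, huA, -, -⟩ := hbu x hxa hxb
    obtain ⟨hv0, hvB, -, -⟩ := hbv x hxa hxb
    have hH2 := hbH x hxa hxb
    rw [hgone _ hs1 hs4, indicator_of_mem (by simpa using hxb), Real.norm_eq_abs, abs_mul]
    have hP : |fderiv ℝ u x x| ≤ √(gradDot u u x) * (2 * r) :=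
      (abs_fderiv_self_le u x).trans (by gcongr)
    have hQ : |fderiv ℝ v x x| ≤ √(gradDot v v x) * (2 * r) :=
      (abs_fderiv_self_le v x).trans (by gcongr)
    have hG := abs_gradDot_le u v x
    have hsu := Real.sq_sqrt hGu
    have hsv := Real.sq_sqrt hGv
    set a := √(gradDot u u x)
    set b := √(gradDot v v x)
    have ha0 : 0 ≤ a := Real.sqrt_nonneg _
    have hb0 : 0 ≤ b := Real.sqrt_nonneg _
    rw [← hsu, ← hsv]
    have hyoung : a * b ≤ 1 / 2 * (B / A * a ^ 2 + A / B * b ^ 2) := by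
      have : 1 / 2 * (B / A * a ^ 2 + A / B * b ^ 2) - a * b =
          1 / 2 * ((B * a - A * b) ^ 2 / (A * B)) := by
        field_simp
        ring
      have h2 : 0 ≤ 1 / 2 * ((B * a - A * b) ^ 2 / (A * B)) := by positivity
      linarith
    have hyu : B * (a * (2 * r)) ≤ r ^ 2 * (B / A * a ^ 2) + A * B := by
      have : r ^ 2 * (B / A * a ^ 2) + A * B - B * (a * (2 * r)) =
          B / A * (r * a - A) ^ 2 := by
        field_simp
        ring
      have h2 : 0 ≤ B / A * (r * a - A) ^ 2 := by positivity
      linarith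
    have hyv : A * (b * (2 * r)) ≤ r ^ 2 * (A / B * b ^ 2) + A * B := by
      have : r ^ 2 * (A / B * b ^ 2) + A * B - A * (b * (2 * r)) =
          A / B * (r * b - B) ^ 2 := by
        field_simp
        ring
      have h2 : 0 ≤ A / B * (r * b - B) ^ 2 := by positivity
      linarith
    set X := B / A * a ^ 2 with hX
    set Y := A / B * b ^ 2 with hY
    have hX0 : 0 ≤ X := by positivity
    have hY0 : 0 ≤ Y := by positivity
    have hflux : |pohozaevFlux u v H lam mu x| ≤
        (6 + |lam| + |mu|) * (r ^ 2 * X + r ^ 2 * Y + A * B) := by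
      have t1 : |2 * (fderiv ℝ u x x * fderiv ℝ v x x)| ≤ 8 * r ^ 2 * (a * b) := by
        rw [abs_mul, abs_mul, abs_two]
        calc 2 * (|fderiv ℝ u x x| * |fderiv ℝ v x x|)
            ≤ 2 * (a * (2 * r) * (b * (2 * r))) := by gcongr
          _ = _ := by ring
      have t2 : |gradDot u v x * ‖x‖ ^ 2| ≤ 4 * r ^ 2 * (a * b) := by
        rw [abs_mul, abs_of_nonneg (sq_nonneg ‖x‖)]
        calc |gradDot u v x| * ‖x‖ ^ 2 ≤ a * b * (2 * r) ^ 2 := by gcongr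
          _ = _ := by ring
      have t3 : |H x * ‖x‖ ^ 2| ≤ 2 * (A * B) := by
        rwa [abs_mul, abs_of_nonneg (sq_nonneg ‖x‖)]
      have t4 : |lam * (v x * fderiv ℝ u x x)| ≤ |lam| * (r ^ 2 * X + A * B) := by
        rw [abs_mul, abs_mul, abs_of_nonneg hv0]
        gcongr
        exact (mul_le_mul hvB hP (abs_nonneg _) hB.le).trans hyu
      have t5 : |mu * (u x * fderiv ℝ v x x)| ≤ |mu| * (r ^ 2 * Y + A * B) := by
        rw [abs_mul, abs_mul, abs_of_nonneg hu0]
        gcongr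
        exact (mul_le_mul huA hQ (abs_nonneg _) hA.le).trans hyv
      have hsum : |pohozaevFlux u v H lam mu x| ≤
          |2 * (fderiv ℝ u x x * fderiv ℝ v x x)| + |gradDot u v x * ‖x‖ ^ 2| +
          |H x * ‖x‖ ^ 2| + |lam * (v x * fderiv ℝ u x x)| +
          |mu * (u x * fderiv ℝ v x x)| := by
        unfold pohozaevFlux
        refine (abs_add_le _ _).trans (add_le_add_left ?_ _)
        refine (abs_add_le _ _).trans (add_le_add_left ?_ _)
        refine (abs_add_le _ _).trans (add_le_add_left ?_ _)
        exact abs_sub _ _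
      have hab : r ^ 2 * (a * b) ≤ r ^ 2 * (1 / 2 * (X + Y)) := by gcongr
      have n1 : 0 ≤ |lam| * (r ^ 2 * Y) := by positivity
      have n2 : 0 ≤ |mu| * (r ^ 2 * X) := by positivity
      have n3 : 0 ≤ A * B := by positivity
      linarith
    calc |deriv θ (‖x‖ ^ 2 / r ^ 2)| * |2 / r ^ 2 * pohozaevFlux u v H lam mu x|
        ≤ M * (2 / r ^ 2 * ((6 + |lam| + |mu|) * (r ^ 2 * X + r ^ 2 * Y + A * B))) := by
          rw [abs_mul, abs_of_nonneg (show (0 : ℝ) ≤ 2 / r ^ 2 by positivity)]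
          gcongr
          exact hθM _
      _ = c * (B / A * (1 ^ 2 * a ^ 2) + A / B * (1 ^ 2 * b ^ 2) + A * B / r ^ 2) := by
          rw [one_pow, one_mul, one_mul, ← hX, ← hY, hc]
          field_simp
  have hint := norm_integral_le_of_norm_le
    ((((hIu.const_mul (B / A)).fun_add (hIv.const_mul (A / B))).fun_add hIK).const_mul c)
    (Filter.Eventually.of_forall hpt)
  rw [integral_const_mul, integral_add ((hIu.const_mul (B / A)).fun_add (hIv.const_mul (A / B))) hIK,
    integral_add (hIu.const_mul (B / A)) (hIv.const_mul (A / B)), integral_const_mul,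
    integral_const_mul, integral_indicator measurableSet_closedBall, setIntegral_const,
    smul_eq_mul, Real.norm_eq_abs] at hint
  refine hint.trans ?_
  have h1 := mul_le_mul_of_nonneg_left hCu (show 0 ≤ B / A by positivity)
  have h2 := mul_le_mul_of_nonneg_left hCv (show 0 ≤ A / B by positivity)
  have e1 : B / A * (2 * ((4 + 128 * M ^ 2) * A ^ 2 / r ^ 2 * W)) =
      2 * (4 + 128 * M ^ 2) * (A * B / r ^ 2 * W) := by
    field_simp
  have e2 : A / B * (2 * ((4 + 128 * M ^ 2) * B ^ 2 / r ^ 2 * W)) =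
      2 * (4 + 128 * M ^ 2) * (A * B / r ^ 2 * W) := by
    field_simp
  rw [e1] at h1
  rw [e2] at h2
  rw [mul_assoc c]
  refine mul_le_mul_of_nonneg_left ?_ hc0
  have e3 : volume.real (closedBall (0 : Euc N) (4 * r)) * (A * B / r ^ 2) =
    A * B / r ^ 2 * W := mul_comm _ _
  linarith

lemma integral_flux_sub {θ : ℝ → ℝ}
    (hθ : ContDiff ℝ 1 θ) (hθ0 : ∀ t, t ≤ 1 → θ t = 0) (hθ1 : ∀ t, 4 ≤ t → θ t = 1)
    (hθs : ∀ t, deriv θ t ≠ 0 → 1 ≤ t ∧ t ≤ 4)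
    (hu : ∀ x, x ≠ 0 → ContDiffAt ℝ 2 u x) (hv : ∀ x, x ≠ 0 → ContDiffAt ℝ 2 v x)
    (hH : ∀ x, x ≠ 0 → ContDiffAt ℝ 1 H x) {ε R : ℝ} (hε : 0 < ε) (hR : ε ≤ R) :
    VanishesOffAnnulus (fun x : Euc N => θ (‖x‖ ^ 2 / ε ^ 2) - θ (‖x‖ ^ 2 / R ^ 2)) ∧
    ∫ x : Euc N, (θ (‖x‖ ^ 2 / ε ^ 2) - θ (‖x‖ ^ 2 / R ^ 2)) *
        ∑ j, fderiv ℝ (pohozaevField u v H lam mu j) x (stdVec j) =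
      (∫ x, deriv θ (‖x‖ ^ 2 / R ^ 2) * ((2 / R ^ 2) * pohozaevFlux u v H lam mu x)) -
      ∫ x, deriv θ (‖x‖ ^ 2 / ε ^ 2) * ((2 / ε ^ 2) * pohozaevFlux u v H lam mu x) := by
  have hR0 : 0 < R := hε.trans_le hR
  have hφ : VanishesOffAnnulus
      (fun x : Euc N => θ (‖x‖ ^ 2 / ε ^ 2) - θ (‖x‖ ^ 2 / R ^ 2)) := by
    refine ⟨ε, 2 * R, hε, fun x hx => ⟨?_, ?_⟩⟩
    · by_contra! hlt
      refine hx ?_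
      dsimp only
      rw [hθ0, hθ0, sub_zero]
      · rw [div_le_one (by positivity)]
        have := hlt.trans_le hR
        gcongr
      · rw [div_le_one (by positivity)]
        gcongr
    · by_contra! hlt
      refine hx ?_
      dsimp only
      rw [hθ1, hθ1, sub_self]
      · rw [le_div_iff₀ (by positivity)]
        nlinarith
      · rw [le_div_iff₀ (by positivity)]
        nlinarith
  refine ⟨hφ, ?_⟩
  have hd : Differentiable ℝ θ := hθ.differentiable one_ne_zero
  have hφc := (contDiff_radial (N := N) hθ ε).sub (contDiff_radial (N := N) hθ R)
  have hds : ∀ t, deriv θ t ≠ 0 → 1 / 4 ≤ t ∧ t ≤ 16 := fun t ht => by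
    have := hθs t ht
    constructor <;> linarith
  have hdc : Continuous (deriv θ) := hθ.continuous_deriv le_rfl
  have hI : ∀ r : ℝ, 0 < r → Integrable fun x =>
      deriv θ (‖x‖ ^ 2 / r ^ 2) * ((2 / r ^ 2) * pohozaevFlux u v H lam mu x) := fun r hr =>
    (vanishesOffAnnulus_radial hds hr).integrable_mul
      (hdc.comp ((continuous_norm.pow 2).div_const _)) fun x hx =>
        continuousAt_const.mul (continuousAt_pohozaevFlux (hu x hx) (hv x hx) (hH x hx))
  rw [integral_mul_div hφ hφc fun j x hx =>
    contDiffAt_pohozaevField (hu x hx) (hv x hx) (hH x hx) j,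
    ← integral_sub (hI R hR0) (hI ε hε), ← integral_neg]
  refine integral_congr_ae (Filter.Eventually.of_forall fun x => ?_)
  have hsub : fderiv ℝ (fun x : Euc N => θ (‖x‖ ^ 2 / ε ^ 2) - θ (‖x‖ ^ 2 / R ^ 2)) x =
      fderiv ℝ (fun x : Euc N => θ (‖x‖ ^ 2 / ε ^ 2)) x -
      fderiv ℝ (fun x : Euc N => θ (‖x‖ ^ 2 / R ^ 2)) x :=
    fderiv_fun_sub (hasFDerivAt_radial hd ε x).differentiableAt
      (hasFDerivAt_radial hd R x).differentiableAt
  simp only [hsub, sub_apply, sub_mul, Finset.sum_sub_distrib]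
  rw [sum_fderiv_radial_mul hd, sum_fderiv_radial_mul hd, sum_pohozaevField_mul]
  ring

end

lemma exists_cutoffs : ∃ (θ g : ℝ → ℝ) (M : ℝ),
    (ContDiff ℝ 1 θ ∧ (∀ t, t ≤ 1 → θ t = 0) ∧ (∀ t, 4 ≤ t → θ t = 1) ∧ Monotone θ ∧
      (∀ t, deriv θ t ≠ 0 → 1 ≤ t ∧ t ≤ 4) ∧ ∀ t, |deriv θ t| ≤ M) ∧
    ContDiff ℝ 1 g ∧ (∀ t, g t ≠ 0 → 1 / 4 ≤ t ∧ t ≤ 16) ∧ (∀ t, |g t| ≤ 1) ∧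
      (∀ t, 1 ≤ t → t ≤ 4 → g t = 1) ∧ ∀ t, |deriv g t| ≤ M := by
  let θ : ℝ → ℝ := fun t => Real.smoothTransition ((t - 1) / 3)
  have hθ : ContDiff ℝ 1 θ :=
    (Real.smoothTransition.contDiff (n := 1)).comp ((contDiff_id.sub contDiff_const).div_const 3)
  have hθ0 : ∀ t, t ≤ 1 → θ t = 0 := fun t ht =>
    Real.smoothTransition.zero_of_nonpos (by linarith)
  have hθ1 : ∀ t, 4 ≤ t → θ t = 1 := fun t ht =>
    Real.smoothTransition.one_of_one_le (by linarith)
  have hθs : ∀ t, deriv θ t ≠ 0 → 1 ≤ t ∧ t ≤ 4 := by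
    intro t ht
    constructor
    · by_contra! hlt
      have : θ =ᶠ[nhds t] fun _ => 0 := by
        filter_upwards [Iio_mem_nhds hlt] with s hs using hθ0 s (le_of_lt hs)
      exact ht (by rw [this.deriv_eq, deriv_const])
    · by_contra! hlt
      have : θ =ᶠ[nhds t] fun _ => 1 := by
        filter_upwards [Ioi_mem_nhds hlt] with s hs using hθ1 s (le_of_lt hs)
      exact ht (by rw [this.deriv_eq, deriv_const])
  have hθc : HasCompactSupport (deriv θ) :=
    HasCompactSupport.intro (isCompact_Icc (a := (1 : ℝ)) (b := 4)) fun t ht => by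
      by_contra hne
      exact ht (hθs t hne)
  obtain ⟨M₁, hM₁⟩ := hθc.exists_bound_of_continuous (hθ.continuous_deriv le_rfl)
  let g : ContDiffBump (5 / 2 : ℝ) := ⟨3 / 2, 2, by norm_num, by norm_num⟩
  have hg : ContDiff ℝ 1 g := g.contDiff
  obtain ⟨M₂, hM₂⟩ := (g.hasCompactSupport.deriv).exists_bound_of_continuous
    (hg.continuous_deriv le_rfl)
  refine ⟨θ, g, max M₁ M₂, ⟨hθ, hθ0, hθ1, fun s t hst => Real.smoothTransition.monotone ?_, hθs,
    fun t => (hM₁ t).trans (le_max_left _ _)⟩, hg, fun t ht => ?_, fun t => ?_, fun t h1 h4 => ?_,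
    fun t => (hM₂ t).trans (le_max_right _ _)⟩
  · linarith
  · have : t ∈ Function.support g := ht
    rw [g.support_eq, Metric.mem_ball, Real.dist_eq, abs_lt] at this
    have h := this
    simp only [g] at h
    constructor <;> linarith
  · rw [abs_of_nonneg g.nonneg]
    exact g.le_one
  · refine g.one_of_mem_closedBall ?_
    rw [Metric.mem_closedBall, Real.dist_eq, abs_le]
    simp only [g]
    constructor <;> linarith

lemma contDiffAt_norm_rpow_mul_rpow {N : ℕ} {v : Euc N → ℝ} {x : Euc N} (hx : x ≠ 0)
    (hv : ContDiffAt ℝ 2 v x) (hv0 : 0 < v x) (a p : ℝ) :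
    ContDiffAt ℝ 1 (fun y => ‖y‖ ^ a * v y ^ p) x :=
  ((contDiffAt_norm ℝ hx).rpow_const_of_ne (norm_ne_zero_iff.2 hx)).mul
    ((hv.of_le (by norm_num)).rpow_const_of_ne hv0.ne')

/-- Euler's relation for a weighted power. -/
lemma fderiv_norm_rpow_mul_rpow_self {N : ℕ} {v : Euc N → ℝ} {x : Euc N} (hx : x ≠ 0)
    (hv : DifferentiableAt ℝ v x) (hv0 : 0 < v x) (a p : ℝ) :
    fderiv ℝ (fun y => ‖y‖ ^ a * v y ^ (p + 1)) x x =
      a * (‖x‖ ^ a * v x ^ (p + 1)) + (p + 1) * (‖x‖ ^ a * v x ^ p) * fderiv ℝ v x x := by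
  have hn0 : ‖x‖ ≠ 0 := norm_ne_zero_iff.2 hx
  have hn : DifferentiableAt ℝ (‖·‖ : Euc N → ℝ) x :=
    (contDiffAt_norm ℝ (n := 1) hx).differentiableAt one_ne_zero
  have h := (hn.hasFDerivAt.rpow_const (p := a) (Or.inl hn0)).fun_mul
    (hv.hasFDerivAt.rpow_const (p := p + 1) (Or.inl hv0.ne'))
  rw [h.fderiv]
  simp only [add_apply, smul_apply, smul_eq_mul, hn.fderiv_norm_self, add_sub_cancel_right]
  rw [Real.rpow_sub_one hn0]
  field_simp
  ring

/-- A subcritical power potential has a positive divergence in the Rellich–Pohozaev identity. -/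
lemma div_pohozaevField_of_system {N : ℕ} {p q a b lam mu : ℝ} (hp : 0 < p) (hq : 0 < q)
    (hlm : lam + mu = N - 2) {u v : Euc N → ℝ} {x : Euc N} (hx : x ≠ 0)
    (hu : ContDiffAt ℝ 2 u x) (hv : ContDiffAt ℝ 2 v x) (hu0 : 0 < u x) (hv0 : 0 < v x)
    (hlu : lap u x = -(‖x‖ ^ a * v x ^ p)) (hlv : lap v x = -(‖x‖ ^ b * u x ^ q)) :
    ∑ j, fderiv ℝ (pohozaevField u v (fun y => (p + 1)⁻¹ * (‖y‖ ^ a * v y ^ (p + 1)) +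
        (q + 1)⁻¹ * (‖y‖ ^ b * u y ^ (q + 1))) lam mu j) x (stdVec j) =
      ((N + a) / (p + 1) - lam) * (‖x‖ ^ a * v x ^ (p + 1)) +
      ((N + b) / (q + 1) - mu) * (‖x‖ ^ b * u x ^ (q + 1)) := by
  have h1 := contDiffAt_norm_rpow_mul_rpow hx hv hv0 a (p + 1)
  have h2 := contDiffAt_norm_rpow_mul_rpow hx hu hu0 b (q + 1)
  have hd1 := (h1.differentiableAt one_ne_zero).hasFDerivAt.const_mul ((p + 1)⁻¹)
  have hd2 := (h2.differentiableAt one_ne_zero).hasFDerivAt.const_mul ((q + 1)⁻¹)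
  rw [div_pohozaevField hu hv ((contDiffAt_const.mul h1).add (contDiffAt_const.mul h2)),
    (hd1.fun_add hd2).fderiv]
  simp only [add_apply, smul_apply, smul_eq_mul]
  rw [fderiv_norm_rpow_mul_rpow_self hx (hv.differentiableAt two_ne_zero) hv0,
    fderiv_norm_rpow_mul_rpow_self hx (hu.differentiableAt two_ne_zero) hu0, hlu, hlv,
    Real.rpow_add_one hv0.ne', Real.rpow_add_one hu0.ne', show mu = N - 2 - lam by linarith]
  field_simp
  ring

lemma volume_closedBall_four_mul (N : ℕ) {r : ℝ} (hr : 0 < r) :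
    volume.real (closedBall (0 : Euc N) (4 * r)) =
      (4 * r) ^ N * volume.real (closedBall (0 : Euc N) 1) := by
  rw [Measure.addHaar_real_closedBall' _ _ (by positivity)]
  simp

/-- Euler-type bound for a weighted power: `|x|^2 |x|^a v^{p+1} ≤ A B`. -/
lemma norm_sq_mul_potential_le {a p s w A B : ℝ} (hs : 0 ≤ s) (hp : 0 < p) (hw : 0 < w)
    (hA : s ^ 2 * (s ^ a * w ^ p) ≤ A) (hB : w ≤ B) :
    0 ≤ (p + 1)⁻¹ * (s ^ a * w ^ (p + 1)) ∧
      (p + 1)⁻¹ * (s ^ a * w ^ (p + 1)) * s ^ 2 ≤ A * B := by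
  have h0 : 0 ≤ s ^ 2 * (s ^ a * w ^ p) := by positivity
  refine ⟨by positivity, ?_⟩
  rw [Real.rpow_add_one hw.ne']
  have h1 : (p + 1)⁻¹ ≤ 1 := inv_le_one_of_one_le₀ (by linarith)
  have hA0 : 0 ≤ A := h0.trans hA
  calc (p + 1)⁻¹ * (s ^ a * (w ^ p * w)) * s ^ 2
      = (p + 1)⁻¹ * (s ^ 2 * (s ^ a * w ^ p) * w) := by ring
    _ ≤ 1 * (A * B) := by gcongr
    _ = A * B := one_mul _

/-- Theorem 1.4 (ii): no positive solution of the subcritical Hénon–Lane–Emden system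
satisfying the decay `u = O(|x|^{-α̃})`, `v = O(|x|^{-β̃})` as `|x| → ∞`. -/
theorem stmt_1 (N : ℕ) (hN : 3 ≤ N) (p q a b : ℝ)
    (hp : 0 < p) (hq : 0 < q) (hpq : 1 < p * q)
    (ha : -2 < a) (hb : -2 < b)
    (hsub : ((N : ℝ) + a) / (p + 1) + ((N : ℝ) + b) / (q + 1) > (N : ℝ) - 2) :
    ¬ ∃ (u v : Euc N → ℝ),
        IsHLESol p q a b u v ∧ (∀ x, 0 < u x) ∧ (∀ x, 0 < v x) ∧
        ∃ C R₀ : ℝ, 0 < C ∧ 0 < R₀ ∧ ∀ x : Euc N, R₀ ≤ ‖x‖ →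
          u x ≤ C * ‖x‖ ^ (-((2 * (p + 1) + a + p * b) / (p * q - 1))) ∧
          v x ≤ C * ‖x‖ ^ (-((2 * (q + 1) + b + q * a) / (p * q - 1))) := by
  rintro ⟨u, v, ⟨hu2, hv2, huc, hvc, hequ, heqv⟩, hu0, hv0, C, R₀, hC, hR₀, hdecay⟩
  have hopen : IsOpen {x : Euc N | x ≠ 0} := isOpen_ne
  have hu : ∀ x, x ≠ 0 → ContDiffAt ℝ 2 u x := fun x hx => hu2.contDiffAt (hopen.mem_nhds hx)
  have hv : ∀ x, x ≠ 0 → ContDiffAt ℝ 2 v x := fun x hx => hv2.contDiffAt (hopen.mem_nhds hx)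
  have habs : ∀ w s : ℝ, 0 < w → |w| ^ (s - 1) * w = w ^ s := fun w s hw => by
    rw [abs_of_pos hw, Real.rpow_sub_one hw.ne', div_mul_cancel₀ _ hw.ne']
  have hlu : ∀ x, x ≠ 0 → -lap u x = ‖x‖ ^ a * v x ^ p := fun x hx => by
    rw [hequ x hx, habs _ _ (hv0 x)]
  have hlv : ∀ x, x ≠ 0 → -lap v x = ‖x‖ ^ b * u x ^ q := fun x hx => by
    rw [heqv x hx, habs _ _ (hu0 x)]
  obtain ⟨θ, g, M, ⟨hθ, hθ0, hθ1, hθm, hθs, hθM⟩, hg, hgs, hg1, hgone, hgM⟩ := exists_cutoffs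
  -- the weights
  set δ := ((N : ℝ) + a) / (p + 1) + ((N : ℝ) + b) / (q + 1) - ((N : ℝ) - 2) with hδ
  have hδ0 : 0 < δ := by linarith
  set lam := ((N : ℝ) + a) / (p + 1) - δ / 2 with hlam
  set mu := (N : ℝ) - 2 - lam with hmu
  set H : Euc N → ℝ := fun y => (p + 1)⁻¹ * (‖y‖ ^ a * v y ^ (p + 1)) +
    (q + 1)⁻¹ * (‖y‖ ^ b * u y ^ (q + 1)) with hHdef
  have hH : ∀ x, x ≠ 0 → ContDiffAt ℝ 1 H x := fun x hx =>
    (contDiffAt_const.mul (contDiffAt_norm_rpow_mul_rpow hx (hv x hx) (hv0 x) a (p + 1))).add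
      (contDiffAt_const.mul (contDiffAt_norm_rpow_mul_rpow hx (hu x hx) (hu0 x) b (q + 1)))
  set E : Euc N → ℝ := fun x => ∑ j, fderiv ℝ (pohozaevField u v H lam mu j) x (stdVec j)
    with hEdef
  have hEpos : ∀ x, x ≠ 0 → 0 < E x := by
    intro x hx
    have h := div_pohozaevField_of_system (lam := lam) (mu := mu) hp hq (by rw [hmu]; ring) hx
      (hu x hx) (hv x hx) (hu0 x) (hv0 x)
      (by rw [← hlu x hx, neg_neg]) (by rw [← hlv x hx, neg_neg])
    have e1 : ((N : ℝ) + a) / (p + 1) - lam = δ / 2 := by rw [hlam]; ring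
    have e2 : ((N : ℝ) + b) / (q + 1) - mu = δ / 2 := by rw [hmu, hlam, hδ]; ring
    rw [e1, e2] at h
    have hn : 0 < ‖x‖ := norm_pos_iff.2 hx
    have hvx := hv0 x
    have hux := hu0 x
    refine lt_of_lt_of_eq ?_ h.symm
    positivity
  have hEcont : ∀ x, x ≠ 0 → ContinuousAt E x := fun x hx => tendsto_finsetSum _ fun j _ =>
    ((contDiffAt_pohozaevField (hu x hx) (hv x hx) (hH x hx) j).continuousAt_fderiv
      one_ne_zero).clm_apply continuousAt_const
  set J : ℝ → ℝ := fun r =>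
    ∫ x, deriv θ (‖x‖ ^ 2 / r ^ 2) * ((2 / r ^ 2) * pohozaevFlux u v H lam mu x) with hJdef
  have hflux := fun {ε R : ℝ} (hε : 0 < ε) (hR : ε ≤ R) =>
    integral_flux_sub (lam := lam) (mu := mu) hθ hθ0 hθ1 hθs hu hv hH hε hR
  -- the flux bound on annuli
  obtain ⟨C₀, hC₀, hJ⟩ : ∃ C₀ : ℝ, 0 ≤ C₀ ∧ ∀ r A B : ℝ, 0 < r → 0 < A → 0 < B →
      (∀ x : Euc N, r / 2 ≤ ‖x‖ → ‖x‖ ≤ 4 * r → u x ≤ A ∧ v x ≤ B ∧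
        ‖x‖ ^ 2 * (‖x‖ ^ a * v x ^ p) ≤ A ∧ ‖x‖ ^ 2 * (‖x‖ ^ b * u x ^ q) ≤ B) →
      |J r| ≤ C₀ * (A * B / r ^ 2 * r ^ N) := by
    have hM0 : 0 ≤ M := (abs_nonneg _).trans (hθM 0)
    refine ⟨2 * M * (6 + |lam| + |mu|) * (4 * (4 + 128 * M ^ 2) + 1) *
      (4 ^ N * volume.real (closedBall (0 : Euc N) 1)), by positivity,
      fun r A B hr hA hB hbd => ?_⟩
    have hne : ∀ x : Euc N, r / 2 ≤ ‖x‖ → x ≠ 0 := fun x hx =>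
      norm_pos_iff.1 (lt_of_lt_of_le (by positivity) hx)
    have h := abs_integral_flux_le (H := H) (lam := lam) (mu := mu) hθs hθM hg hgs hg1 hgone hgM
      hu hv hr hA hB
      (fun x h1 h2 => by
        obtain ⟨k1, k2, k3, k4⟩ := hbd x h1 h2
        rw [hlu x (hne x h1)]
        have := hv0 x
        exact ⟨(hu0 x).le, k1, by positivity, k3⟩)
      (fun x h1 h2 => by
        obtain ⟨k1, k2, k3, k4⟩ := hbd x h1 h2
        rw [hlv x (hne x h1)]
        have := hu0 x
        exact ⟨(hv0 x).le, k2, by positivity, k4⟩)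
      (fun x h1 h2 => by
        obtain ⟨k1, k2, k3, k4⟩ := hbd x h1 h2
        have m1 := norm_sq_mul_potential_le (norm_nonneg x) hp (hv0 x) k3 k2
        have m2 := norm_sq_mul_potential_le (norm_nonneg x) hq (hu0 x) k4 k1
        rw [abs_of_nonneg (add_nonneg m1.1 m2.1)]
        linarith [m1.2, m2.2])
    rw [volume_closedBall_four_mul N hr] at h
    refine h.trans (le_of_eq ?_)
    rw [mul_pow]
    ring
  -- the flux is bounded from below
  set c := J 2 - J 1 with hc
  have hN0 : 0 < N := by omega
  have hmono : ∀ {ε R : ℝ}, 0 < ε → ε ≤ 1 → 2 ≤ R → c ≤ J R - J ε := by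
    intro ε R hε hε1 hR
    obtain ⟨hφ, e1⟩ := hflux hε (show ε ≤ R by linarith)
    obtain ⟨hφ', e2⟩ := hflux one_pos one_le_two
    rw [hc]
    have hcont : ∀ r s : ℝ,
        Continuous fun x : Euc N => θ (‖x‖ ^ 2 / r ^ 2) - θ (‖x‖ ^ 2 / s ^ 2) := fun r s =>
      (contDiff_radial hθ r).continuous.sub (contDiff_radial hθ s).continuous
    refine e2.symm.le.trans (le_trans (integral_mono (hφ'.integrable_mul (hcont _ _) hEcont)
      (hφ.integrable_mul (hcont _ _) hEcont) fun x => ?_) e1.le)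
    by_cases hx : x = 0
    · simp [hx]
    · have h1 : θ (‖x‖ ^ 2 / 1 ^ 2) ≤ θ (‖x‖ ^ 2 / ε ^ 2) := hθm (by gcongr)
      have h2 : θ (‖x‖ ^ 2 / R ^ 2) ≤ θ (‖x‖ ^ 2 / 2 ^ 2) := hθm (by gcongr)
      exact mul_le_mul_of_nonneg_right (by linarith) (hEpos x hx).le
  have hcpos : 0 < c := by
    obtain ⟨hφ, e⟩ := hflux one_pos one_le_two
    rw [hc]
    have hcont : Continuous fun x : Euc N => θ (‖x‖ ^ 2 / 1 ^ 2) - θ (‖x‖ ^ 2 / 2 ^ 2) :=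
      (contDiff_radial hθ 1).continuous.sub (contDiff_radial hθ 2).continuous
    refine lt_of_lt_of_eq ?_ e
    refine (hφ.continuous_mul hcont hEcont).integral_pos_of_hasCompactSupport_nonneg_nonzero
      (hφ.mul_right _).hasCompactSupport (fun x => ?_)
      (x := EuclideanSpace.single (⟨0, hN0⟩ : Fin N) (2 : ℝ)) ?_
    · by_cases hx : x = 0
      · simp [hx]
      · have h2 : θ (‖x‖ ^ 2 / 2 ^ 2) ≤ θ (‖x‖ ^ 2 / 1 ^ 2) := hθm (by gcongr; norm_num)
        exact mul_nonneg (by linarith) (hEpos x hx).le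
    · have hx : EuclideanSpace.single (⟨0, hN0⟩ : Fin N) (2 : ℝ) ≠ 0 := by simp
      refine mul_ne_zero ?_ (hEpos _ hx).ne'
      rw [PiLp.norm_single, hθ1 _ (by norm_num), hθ0 _ (by norm_num)]
      norm_num
  -- the flux near the origin
  obtain ⟨C₁, hC₁, hJ0⟩ : ∃ C₁ : ℝ, 0 ≤ C₁ ∧ ∀ ε : ℝ, 0 < ε → ε ≤ 1 → |J ε| ≤ C₁ * ε := by
    obtain ⟨m, hm⟩ := (isCompact_closedBall (0 : Euc N) 4).bddAbove_image
      ((huc.max hvc).continuousOn)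
    have hm' : ∀ x : Euc N, ‖x‖ ≤ 4 → u x ≤ m ∧ v x ≤ m := fun x hx => by
      have := hm (mem_image_of_mem _ (by simpa using hx : x ∈ closedBall (0 : Euc N) 4))
      exact ⟨(le_max_left _ _).trans this, (le_max_right _ _).trans this⟩
    have hm0 : 0 < m := (hu0 0).trans_le (hm' 0 (by simp)).1
    have key : ∀ (s d : ℝ) (w : Euc N → ℝ) (x : Euc N), x ≠ 0 → -2 < d → 0 < s → 0 < w x →
        w x ≤ m → ‖x‖ ≤ 4 → ‖x‖ ^ 2 * (‖x‖ ^ d * w x ^ s) ≤ 4 ^ (2 + d) * m ^ s := by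
      intro s d w x hx hd hs hw hwm hx4
      have hn : 0 < ‖x‖ := norm_pos_iff.2 hx
      rw [← mul_assoc, ← Real.rpow_two, ← Real.rpow_add hn]
      have : 0 ≤ 2 + d := by linarith
      gcongr
    set A := m + 4 ^ (2 + a) * m ^ p with hA
    set B := m + 4 ^ (2 + b) * m ^ q with hB
    have hA0 : 0 < A := by positivity
    have hB0 : 0 < B := by positivity
    refine ⟨C₀ * (A * B), by positivity, fun ε hε hε1 => ?_⟩
    refine (hJ ε A B hε hA0 hB0 fun x h1 h2 => ?_).trans ?_
    · have hx : x ≠ 0 := norm_pos_iff.1 (lt_of_lt_of_le (by positivity) h1)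
      have hx4 : ‖x‖ ≤ 4 := by linarith
      obtain ⟨hum, hvm⟩ := hm' x hx4
      have k1 := key p a v x hx ha hp (hv0 x) hvm hx4
      have k2 := key q b u x hx hb hq (hu0 x) hum hx4
      have n1 : 0 ≤ (4 : ℝ) ^ (2 + a) * m ^ p := by positivity
      have n2 : 0 ≤ (4 : ℝ) ^ (2 + b) * m ^ q := by positivity
      exact ⟨by linarith, by linarith, by linarith, by linarith⟩
    · obtain ⟨n, rfl⟩ := Nat.exists_eq_add_of_le' hN
      have : ε ^ (n + 1) ≤ ε := by
        calc ε ^ (n + 1) = ε ^ n * ε := pow_succ _ _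
          _ ≤ 1 * ε := by
            gcongr
            exact pow_le_one₀ hε.le hε1
          _ = ε := one_mul ε
      calc C₀ * (A * B / ε ^ 2 * ε ^ (n + 3)) = C₀ * (A * B) * ε ^ (n + 1) := by
            field_simp
            ring
        _ ≤ C₀ * (A * B) * ε := by gcongr
  -- the flux near infinity
  set α := (2 * (p + 1) + a + p * b) / (p * q - 1) with hα
  set β := (2 * (q + 1) + b + q * a) / (p * q - 1) with hβ
  have hpq1 : 0 < p * q - 1 := by linarith
  have hα0 : 0 < α := by
    refine div_pos ?_ hpq1
    nlinarith [mul_pos hp (show 0 < b + 2 by linarith)]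
  have hβ0 : 0 < β := by
    refine div_pos ?_ hpq1
    nlinarith [mul_pos hq (show 0 < a + 2 by linarith)]
  have hαmul : α * (p * q - 1) = 2 * (p + 1) + a + p * b := div_mul_cancel₀ _ hpq1.ne'
  have hβmul : β * (p * q - 1) = 2 * (q + 1) + b + q * a := div_mul_cancel₀ _ hpq1.ne'
  have hrelα : 2 + a - β * p = -α :=
    mul_right_cancel₀ hpq1.ne' (by linear_combination hαmul - p * hβmul)
  have hrelβ : 2 + b - α * q = -β :=
    mul_right_cancel₀ hpq1.ne' (by linear_combination hβmul - q * hαmul)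
  set σ := α + β - ((N : ℝ) - 2) with hσ
  have hσ0 : 0 < σ := by
    have h1 : δ * ((p + 1) * (q + 1)) = σ * (p * q - 1) := by
      have ea : a = p * β - α - 2 := by linarith
      have eb : b = q * α - β - 2 := by linarith
      rw [hδ, hσ, ea, eb]
      field_simp
      ring
    have h2 : 0 < σ * (p * q - 1) := h1 ▸ (by positivity)
    exact pos_of_mul_pos_left h2 hpq1.le
  obtain ⟨C₂, hC₂, hJinf⟩ : ∃ C₂ : ℝ, 0 ≤ C₂ ∧ ∀ ρ : ℝ, R₀ ≤ ρ →
      |J (2 * ρ)| ≤ C₂ * ρ ^ (-σ) := by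
    have key : ∀ (s d γ w : ℝ) (x : Euc N), x ≠ 0 → 0 < s → 0 < w →
        w ≤ C * ‖x‖ ^ (-γ) → ‖x‖ ^ 2 * (‖x‖ ^ d * w ^ s) ≤ C ^ s * ‖x‖ ^ (2 + d - γ * s) := by
      intro s d γ w x hx hs hw hwC
      have hn : 0 < ‖x‖ := norm_pos_iff.2 hx
      calc ‖x‖ ^ 2 * (‖x‖ ^ d * w ^ s) ≤ ‖x‖ ^ 2 * (‖x‖ ^ d * (C * ‖x‖ ^ (-γ)) ^ s) := by
            gcongr
        _ = C ^ s * ‖x‖ ^ (2 + d - γ * s) := by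
            rw [Real.mul_rpow hC.le (by positivity), ← Real.rpow_mul hn.le,
              show 2 + d - γ * s = 2 + d + -γ * s by ring, Real.rpow_add hn, Real.rpow_add hn,
              Real.rpow_two]
            ring
    refine ⟨C₀ * ((C + C ^ p) * (C + C ^ q) / 4 * 2 ^ N), by positivity, fun ρ hρ => ?_⟩
    have hρ0 : 0 < ρ := hR₀.trans_le hρ
    have hCp : 0 < C ^ p := Real.rpow_pos_of_pos hC p
    have hCq : 0 < C ^ q := Real.rpow_pos_of_pos hC q
    have hρα : 0 < ρ ^ (-α) := Real.rpow_pos_of_pos hρ0 _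
    have hρβ : 0 < ρ ^ (-β) := Real.rpow_pos_of_pos hρ0 _
    refine (hJ (2 * ρ) ((C + C ^ p) * ρ ^ (-α)) ((C + C ^ q) * ρ ^ (-β)) (by positivity)
      (by positivity) (by positivity) fun x h1 h2 => ?_).trans (le_of_eq ?_)
    · have hρx : ρ ≤ ‖x‖ := by linarith
      have hx : x ≠ 0 := norm_pos_iff.1 (hρ0.trans_le hρx)
      obtain ⟨d1, d2⟩ := hdecay x (hρ.trans hρx)
      have k1 := key p a β (v x) x hx hp (hv0 x) d2
      have k2 := key q b α (u x) x hx hq (hu0 x) d1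
      rw [hrelα] at k1
      rw [hrelβ] at k2
      have hxα : ‖x‖ ^ (-α) ≤ ρ ^ (-α) :=
        Real.rpow_le_rpow_of_nonpos hρ0 hρx (by linarith)
      have hxβ : ‖x‖ ^ (-β) ≤ ρ ^ (-β) :=
        Real.rpow_le_rpow_of_nonpos hρ0 hρx (by linarith)
      have m1 := mul_le_mul_of_nonneg_left hxα hC.le
      have m2 := mul_le_mul_of_nonneg_left hxβ hC.le
      have m3 := mul_le_mul_of_nonneg_left hxα hCp.le
      have m4 := mul_le_mul_of_nonneg_left hxβ hCq.le
      have n1 := mul_pos hC hρα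
      have n2 := mul_pos hC hρβ
      have n3 := mul_pos hCp hρα
      have n4 := mul_pos hCq hρβ
      refine ⟨?_, ?_, ?_, ?_⟩ <;> linarith
    · have e : ρ ^ (-σ) = ρ ^ (-α) * ρ ^ (-β) * ρ ^ N / ρ ^ 2 := by
        rw [show -σ = -α + -β + (N : ℝ) - (2 : ℝ) by rw [hσ]; ring, Real.rpow_sub hρ0,
          Real.rpow_add hρ0, Real.rpow_add hρ0, Real.rpow_natCast, Real.rpow_two]
      rw [e, mul_pow]
      ring
  -- conclusion
  have hlim : Filter.Tendsto (fun ρ : ℝ => C₂ * ρ ^ (-σ)) Filter.atTop (nhds 0) := by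
    simpa using (tendsto_rpow_neg_atTop hσ0).const_mul C₂
  obtain ⟨ρ, hρ, hρ1, hρR⟩ := ((hlim.eventually_lt_const (half_pos hcpos)).and
    ((Filter.eventually_ge_atTop 1).and (Filter.eventually_ge_atTop R₀))).exists
  have hlim0 : Filter.Tendsto (fun ε : ℝ => C₁ * ε) (nhdsWithin 0 (Ioi 0)) (nhds 0) := by
    have : Filter.Tendsto (fun ε : ℝ => C₁ * ε) (nhds 0) (nhds (C₁ * 0)) :=
      (continuous_const.mul continuous_id).tendsto 0
    rw [mul_zero] at this
    exact this.mono_left nhdsWithin_le_nhds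
  obtain ⟨ε, hε, hε0, hε1⟩ := ((hlim0.eventually_lt_const (half_pos hcpos)).and
    (Ioc_mem_nhdsGT (one_pos : (0 : ℝ) < 1))).exists
  have h1 := hmono hε0 hε1 (show 2 ≤ 2 * ρ by linarith)
  have h2 := (le_abs_self _).trans (hJinf ρ hρR)
  have h3 := (neg_le_abs _).trans (hJ0 ε hε0 hε1)
  linarith
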